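/- For 0 < |q| < 1 and parameters x, y (with 1/x, 1/y interpreted by continuity, e.g. x, y nonzero and avoiding poles): ∑_{n=0}^{∞} [(x,y;q)_n / (q;q)_{2n}] (1/(xy))^n (q^n − 1) q^{n²} = (S₁ − S₂ − T₁ + T₂) · (q/x, q/y; q)_∞ / [(q;q)_∞ (q/xy; q)_∞], where S₁ = ∑_{n∈ℤ} [(x,y;q)_{3n} / (q/x, q/y; q)_{3n}] (1/(xy))^{3n} q^{3n²+2n}, S₂ is the same with q^{3n²+n}, T₁ = ∑_{n∈ℤ} [(x,y;q)_{3n+1} / (q/x, q/y; q)_{3n+1}] (1/(xy))^{3n+1} q^{3n²+4n+1}, and T₂ = ∑_{n∈ℤ} [(x,y;q)_{3n+2} / (q/x, q/y; q)_{3n+2}] (1/(xy))^{3n+2} q^{3n²+5n+2}. -/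

import Mathlib

noncomputable def qp (q x : ℂ) (n : ℕ) : ℂ := ∏ i ∈ Finset.range n, (1 - x * q ^ i)

noncomputable def qpInf (q x : ℂ) : ℂ := ∏' i : ℕ, (1 - x * q ^ i)

/-- `(x;q)_n` for `n ∈ ℤ`, defined by `(x;q)_n = (x;q)_∞ / (x q^n; q)_∞`. -/
noncomputable def zqp (q x : ℂ) (n : ℤ) : ℂ := qpInf q x / qpInf q (x * q ^ n)

/-- `1/(q;q)_k` for integer `k`, zero for negative `k`. -/
noncomputable def ri (q : ℂ) (k : ℤ) : ℂ := if k < 0 then 0 else (qp q q k.toNat)⁻¹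

lemma one_sub_pow_ne {q : ℂ} (h1 : ‖q‖ < 1) (n : ℕ) : 1 - q ^ (n + 1) ≠ 0 := by
  intro h
  have h2 : q ^ (n + 1) = 1 := (sub_eq_zero.mp h).symm
  have h3 : ‖q‖ ^ (n + 1) = 1 := by rw [← norm_pow, h2, norm_one]
  have h4 : ‖q‖ ^ (n + 1) < 1 := pow_lt_one₀ (norm_nonneg q) h1 (by omega)
  linarith

lemma qp_succ (q x : ℂ) (n : ℕ) : qp q x (n + 1) = qp q x n * (1 - x * q ^ n) := by
  simp [qp, Finset.prod_range_succ]

lemma qp_zero (q x : ℂ) : qp q x 0 = 1 := by simp [qp]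

lemma qp_succ' (q x : ℂ) (n : ℕ) : qp q x (n + 1) = (1 - x) * qp q (x * q) n := by
  simp only [qp, Finset.prod_range_succ']
  rw [mul_comm]
  congr 1
  · simp
  · apply Finset.prod_congr rfl
    intro i _
    ring

lemma qpq_ne {q : ℂ} (h1 : ‖q‖ < 1) (n : ℕ) : qp q q n ≠ 0 := by
  rw [qp, Finset.prod_ne_zero_iff]
  intro i _
  have := one_sub_pow_ne h1 i
  rwa [pow_succ'] at this

lemma ri_neg (q : ℂ) {k : ℤ} (hk : k < 0) : ri q k = 0 := by simp [ri, hk]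

lemma ri_nat (q : ℂ) (k : ℕ) : ri q k = (qp q q k)⁻¹ := by simp [ri]

lemma ri_zero (q : ℂ) : ri q 0 = 1 := by simp [ri, qp]

lemma ri_rec {q : ℂ} (h1 : ‖q‖ < 1) (k : ℤ) : ri q (k - 1) = (1 - q ^ k) * ri q k := by
  rcases lt_trichotomy k 0 with h | h | h
  · rw [ri_neg q h, ri_neg q (by omega)]; simp
  · subst h; rw [ri_neg q (by omega)]; simp
  · obtain ⟨n, rfl⟩ : ∃ n : ℕ, k = n + 1 := ⟨(k - 1).toNat, by omega⟩
    have e : ((n : ℤ) + 1) = ((n + 1 : ℕ) : ℤ) := by push_cast; ring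
    rw [add_sub_cancel_right, e, ri_nat, ri_nat, zpow_natCast, qp_succ, mul_inv, ← pow_succ']
    have := one_sub_pow_ne h1 n
    field_simp

/-- product of two -/
noncomputable def vv (q : ℂ) (a b : ℤ) : ℂ := ri q a * ri q b

lemma vv_comm (q : ℂ) (a b : ℤ) : vv q a b = vv q b a := by unfold vv; ring

lemma pas1 {q : ℂ} (h0 : q ≠ 0) (h1 : ‖q‖ < 1) (a b : ℤ) :
    (1 - q ^ (a + b)) * vv q a b = vv q a (b - 1) + q ^ b * vv q (a - 1) b := by
  unfold vv
  rw [ri_rec h1, ri_rec h1, zpow_add₀ h0]; ring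

lemma pas2 {q : ℂ} (h0 : q ≠ 0) (h1 : ‖q‖ < 1) (a b : ℤ) :
    (1 - q ^ (a + b)) * vv q a b = q ^ a * vv q a (b - 1) + vv q (a - 1) b := by
  unfold vv
  rw [ri_rec h1, ri_rec h1, zpow_add₀ h0]; ring

lemma vv_supp (q : ℂ) (a b : ℤ) (h : vv q a b ≠ 0) : 0 ≤ a ∧ 0 ≤ b := by
  by_contra hc
  apply h
  unfold vv
  by_cases ha : a < 0
  · rw [ri_neg q ha, zero_mul]
  · rw [ri_neg q (by omega : b < 0), mul_zero]

lemma summ_vv (q : ℂ) (c : ℤ → ℂ) (s t : ℤ) :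
    Summable (fun m : ℤ => c m * vv q (s - 3 * m) (t + 3 * m)) := by
  apply summable_of_ne_finset_zero (s := Finset.Icc (-|t|) |s|)
  intro m hm
  by_contra hne
  have := vv_supp q _ _ (right_ne_zero_of_mul hne)
  apply hm
  rw [Finset.mem_Icc]
  have := le_abs_self s
  have := le_abs_self t
  have := abs_nonneg s
  have := abs_nonneg t
  constructor <;> omega

lemma canc_neg {h : ℤ → ℂ} (hs : Summable h) : HasSum (fun m => h m - h (-m)) 0 := by
  have := hs.hasSum.sub ((Equiv.neg ℤ).hasSum_iff.mpr hs.hasSum)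
  simpa [Function.comp_def] using this

lemma canc_neg1 {h : ℤ → ℂ} (hs : Summable h) : HasSum (fun m => h m - h (-m - 1)) 0 := by
  have := hs.hasSum.sub (((Equiv.neg ℤ).trans (Equiv.subRight 1)).hasSum_iff.mpr hs.hasSum)
  simpa [Function.comp_def] using this

noncomputable def tA (q : ℂ) (n m : ℤ) : ℂ :=
  q ^ (3 * m ^ 2 - m) * vv q (n - 3 * m) (n + 3 * m)
    - q ^ (3 * m ^ 2 + m) * vv q (n - (3 * m + 1)) (n + (3 * m + 1))

noncomputable def tB (q : ℂ) (n m : ℤ) : ℂ :=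
  q ^ (3 * m ^ 2 + 2 * m) * vv q (n - 3 * m - 1) (n + 3 * m)
    - q ^ (3 * m ^ 2 + 4 * m + 1) * vv q (n - 3 * m - 2) (n + 3 * m + 1)

noncomputable def tC (q : ℂ) (n m : ℤ) : ℂ :=
  q ^ (3 * m ^ 2 - 2 * m) * vv q (n - 3 * m) (n + 3 * m)
    - q ^ (3 * m ^ 2 + 2 * m) * vv q (n - (3 * m + 2)) (n + (3 * m + 2))

lemma hs_congr {f g : ℤ → ℂ} {s : ℂ} (h : ∀ m, f m = g m) (hg : HasSum g s) : HasSum f s := by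
  rwa [show f = g from funext h]

lemma zc {q : ℂ} (h0 : q ≠ 0) (a b c d : ℤ) (h : a + b = c + d) :
    q ^ a * q ^ b = q ^ c * q ^ d := by
  rw [← zpow_add₀ h0, ← zpow_add₀ h0, h]

lemma vvc (q : ℂ) {a b c d : ℤ} (h : a = c) (h' : b = d) : vv q a b = vv q c d := by
  rw [h, h']

lemma vvs (q : ℂ) {a b c d : ℤ} (h : a = d) (h' : b = c) : vv q a b = vv q c d := by
  rw [h, h', vv_comm]

lemma stepAB {q : ℂ} (h0 : q ≠ 0) (h1 : ‖q‖ < 1) (n : ℤ) (s : ℂ)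
    (hB : HasSum (tB q n) s) : HasSum (fun m => (1 - q ^ (2 * n)) * tA q n m) (q ^ n * s) := by
  have hs : Summable (fun m : ℤ => q ^ (3 * m ^ 2 - m) * vv q (n - 3 * m) (n - 1 + 3 * m)) :=
    summ_vv q _ _ _
  have := (hB.mul_left (q ^ n)).add (canc_neg hs)
  rw [add_zero] at this
  refine hs_congr (fun m => ?_) this
  have p1 := pas1 h0 h1 (n - 3 * m) (n + 3 * m)
  have p2 := pas1 h0 h1 (n - (3 * m + 1)) (n + (3 * m + 1))
  rw [show n - 3 * m + (n + 3 * m) = 2 * n by ring,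
    vvc q (rfl : n - 3 * m = _) (show n + 3 * m - 1 = n - 1 + 3 * m by ring)] at p1
  rw [show n - (3 * m + 1) + (n + (3 * m + 1)) = 2 * n by ring,
    vvc q (show n - (3 * m + 1) = n - 3 * m - 1 by ring)
      (show n + (3 * m + 1) - 1 = n + 3 * m by ring),
    vvc q (show n - (3 * m + 1) - 1 = n - 3 * m - 2 by ring)
      (show n + (3 * m + 1) = n + 3 * m + 1 by ring)] at p2
  have e1 := zc h0 (3 * m ^ 2 - m) (n + 3 * m) n (3 * m ^ 2 + 2 * m) (by ring)
  have e2 := zc h0 (3 * m ^ 2 + m) (n + (3 * m + 1)) n (3 * m ^ 2 + 4 * m + 1) (by ring)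
  unfold tA tB
  rw [vvs q (show n - 3 * -m = n + 3 * m by ring) (show n - 1 + 3 * -m = n - 3 * m - 1 by ring),
    show 3 * (-m) ^ 2 - -m = 3 * m ^ 2 + m by ring]
  linear_combination q ^ (3 * m ^ 2 - m) * p1 - q ^ (3 * m ^ 2 + m) * p2
    + e1 * vv q (n - 3 * m - 1) (n + 3 * m) - e2 * vv q (n - 3 * m - 2) (n + 3 * m + 1)

lemma stepBA {q : ℂ} (h0 : q ≠ 0) (h1 : ‖q‖ < 1) (n : ℤ) (s : ℂ)
    (hA : HasSum (tA q (n - 1)) s) :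
    HasSum (fun m => (1 - q ^ (2 * n - 1)) * tB q n m) (q ^ (n - 1) * s) := by
  have hs : Summable (fun m : ℤ => q ^ (3 * m ^ 2 + 2 * m) * vv q (n - 2 - 3 * m) (n + 3 * m)) :=
    summ_vv q _ _ _
  have := (hA.mul_left (q ^ (n - 1))).add (canc_neg1 hs)
  rw [add_zero] at this
  refine hs_congr (fun m => ?_) this
  have p1 := pas2 h0 h1 (n - 3 * m - 1) (n + 3 * m)
  have p2 := pas2 h0 h1 (n - 3 * m - 2) (n + 3 * m + 1)
  rw [show n - 3 * m - 1 + (n + 3 * m) = 2 * n - 1 by ring,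
    vvc q (show n - 3 * m - 1 = n - 1 - 3 * m by ring)
      (show n + 3 * m - 1 = n - 1 + 3 * m by ring),
    vvc q (show n - 3 * m - 1 - 1 = n - 2 - 3 * m by ring) (rfl : n + 3 * m = _)] at p1
  rw [show n - 3 * m - 2 + (n + 3 * m + 1) = 2 * n - 1 by ring,
    vvc q (show n - 3 * m - 2 = n - 1 - (3 * m + 1) by ring)
      (show n + 3 * m + 1 - 1 = n - 1 + (3 * m + 1) by ring)] at p2
  have e1 := zc h0 (3 * m ^ 2 + 2 * m) (n - 3 * m - 1) (n - 1) (3 * m ^ 2 - m) (by ring)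
  have e2 := zc h0 (3 * m ^ 2 + 4 * m + 1) (n - 3 * m - 2) (n - 1) (3 * m ^ 2 + m) (by ring)
  unfold tA tB
  rw [vvs q (show n - 2 - 3 * (-m - 1) = n + 3 * m + 1 by ring)
    (show n + 3 * (-m - 1) = n - 3 * m - 2 - 1 by ring),
    show 3 * (-m - 1) ^ 2 + 2 * (-m - 1) = 3 * m ^ 2 + 4 * m + 1 by ring]
  linear_combination q ^ (3 * m ^ 2 + 2 * m) * p1 - q ^ (3 * m ^ 2 + 4 * m + 1) * p2
    + e1 * vv q (n - 1 - 3 * m) (n - 1 + 3 * m)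
    - e2 * vv q (n - 1 - (3 * m + 1)) (n - 1 + (3 * m + 1))

lemma stepBC {q : ℂ} (h0 : q ≠ 0) (h1 : ‖q‖ < 1) (n : ℤ) (s : ℂ)
    (hB : HasSum (tB q n) s) : HasSum (fun m => (1 - q ^ (2 * n)) * tC q n m) s := by
  have hs1 : Summable (fun m : ℤ => q ^ (3 * m ^ 2 - 2 * m) * vv q (n - 3 * m) (n - 1 + 3 * m)) :=
    summ_vv q _ _ _
  have hs2 : Summable (fun m : ℤ => q ^ (3 * m ^ 2 + 2 * m) *
    vv q (n - 2 - 3 * m) (n + 1 + 3 * m)) := summ_vv q _ _ _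
  have hs3 : Summable (fun m : ℤ => q ^ (3 * m ^ 2 + m) * vv q (n - 1 - 3 * m) (n + 3 * m)) :=
    summ_vv q _ _ _
  have := ((hB.add (canc_neg hs1)).sub (canc_neg1 hs2)).add ((canc_neg1 hs3).mul_left (q ^ n))
  rw [mul_zero, add_zero, add_zero, sub_zero] at this
  refine hs_congr (fun m => ?_) this
  have p1 := pas1 h0 h1 (n - 3 * m) (n + 3 * m)
  have p2 := pas1 h0 h1 (n - (3 * m + 2)) (n + (3 * m + 2))
  rw [show n - 3 * m + (n + 3 * m) = 2 * n by ring,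
    vvc q (rfl : n - 3 * m = _) (show n + 3 * m - 1 = n - 1 + 3 * m by ring),
    vvc q (show n - 3 * m - 1 = n - 1 - 3 * m by ring) (rfl : n + 3 * m = _)] at p1
  rw [show n - (3 * m + 2) + (n + (3 * m + 2)) = 2 * n by ring,
    vvc q (show n - (3 * m + 2) = n - 2 - 3 * m by ring)
      (show n + (3 * m + 2) - 1 = n + 1 + 3 * m by ring)] at p2
  have e1 := zc h0 (3 * m ^ 2 - 2 * m) (n + 3 * m) n (3 * m ^ 2 + m) (by ring)
  have e2 := zc h0 (3 * m ^ 2 + 2 * m) (n + (3 * m + 2)) n (3 * m ^ 2 + 5 * m + 2) (by ring)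
  unfold tC tB
  rw [vvs q (show n - 3 * -m = n + 3 * m by ring) (show n - 1 + 3 * -m = n - 1 - 3 * m by ring),
    show 3 * (-m) ^ 2 - 2 * -m = 3 * m ^ 2 + 2 * m by ring,
    vvs q (show n - 2 - 3 * (-m - 1) = n + 3 * m + 1 by ring)
      (show n + 1 + 3 * (-m - 1) = n - 3 * m - 2 by ring),
    show 3 * (-m - 1) ^ 2 + 2 * (-m - 1) = 3 * m ^ 2 + 4 * m + 1 by ring,
    vvs q (show n - 1 - 3 * (-m - 1) = n + (3 * m + 2) by ring)
      (show n + 3 * (-m - 1) = n - (3 * m + 2) - 1 by ring),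
    show 3 * (-m - 1) ^ 2 + (-m - 1) = 3 * m ^ 2 + 5 * m + 2 by ring,
    vvc q (show n - 3 * m - 1 = n - 1 - 3 * m by ring) (rfl : n + 3 * m = _)]
  linear_combination q ^ (3 * m ^ 2 - 2 * m) * p1 - q ^ (3 * m ^ 2 + 2 * m) * p2
    + e1 * vv q (n - 1 - 3 * m) (n + 3 * m) - e2 * vv q (n - (3 * m + 2) - 1) (n + (3 * m + 2))

lemma vv_zero_off (q : ℂ) (r : ℤ) (h : r ≠ 0) : vv q (0 - r) (0 + r) = 0 := by
  by_contra hc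
  have := vv_supp _ _ _ hc
  omega

lemma one_sub_zpow_ne {q : ℂ} (h1 : ‖q‖ < 1) (k : ℤ) (hk : 0 < k) : 1 - q ^ k ≠ 0 := by
  obtain ⟨n, rfl⟩ : ∃ n : ℕ, k = n + 1 := ⟨(k - 1).toNat, by omega⟩
  exact_mod_cast one_sub_pow_ne h1 n

lemma hasSum_scale {f : ℤ → ℂ} {a s : ℂ} (ha : a ≠ 0) (h : HasSum (fun m => a * f m) (a * s)) :
    HasSum f s := by
  have := h.mul_left a⁻¹
  simpa [inv_mul_cancel_left₀ ha] using this

lemma sumB_of_A {q : ℂ} (h0 : q ≠ 0) (h1 : ‖q‖ < 1) (n : ℤ) (hn : 0 ≤ n)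
    (hA : HasSum (tA q n) (q ^ (n ^ 2) * ri q (2 * n))) :
    HasSum (tB q (n + 1)) (q ^ (n ^ 2 + n) * ri q (2 * n + 1)) := by
  have := stepBA h0 h1 (n + 1) _ (by rw [add_sub_cancel_right]; exact hA)
  refine hasSum_scale (one_sub_zpow_ne h1 (2 * (n + 1) - 1) (by omega)) ?_
  convert this using 1
  have r := ri_rec h1 (2 * n + 1)
  rw [add_sub_cancel_right] at r
  rw [r, show 2 * (n + 1) - 1 = 2 * n + 1 by ring, show n + 1 - 1 = n by ring, zpow_add₀ h0 (n ^ 2) n]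
  ring

lemma sumA {q : ℂ} (h0 : q ≠ 0) (h1 : ‖q‖ < 1) (n : ℕ) :
    HasSum (tA q n) (q ^ ((n : ℤ) ^ 2) * ri q (2 * n)) := by
  induction n with
  | zero =>
    have : HasSum (tA q ((0 : ℕ) : ℤ)) (tA q ((0 : ℕ) : ℤ) 0) := by
      apply hasSum_single
      intro m hm
      unfold tA
      rw [Nat.cast_zero, vv_zero_off _ _ (by omega), vv_zero_off _ _ (by omega)]
      simp
    convert this using 1
    unfold tA
    rw [Nat.cast_zero, vv_zero_off q (3 * 0 + 1) (by omega)]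
    simp [vv, ri_zero]
  | succ n ih =>
    have hB := sumB_of_A h0 h1 n (by omega) ih
    have := stepAB h0 h1 (n + 1) _ hB
    push_cast
    refine hasSum_scale (one_sub_zpow_ne h1 (2 * ((n : ℤ) + 1)) (by omega)) ?_
    convert this using 1
    have r := ri_rec h1 (2 * ((n : ℤ) + 1))
    rw [show 2 * ((n : ℤ) + 1) - 1 = 2 * n + 1 by ring] at r
    rw [r]
    have := zc h0 (((n : ℤ) + 1) ^ 2) 0 (n + 1) ((n : ℤ) ^ 2 + n) (by ring)
    rw [zpow_zero, mul_one] at this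
    rw [this]; ring

lemma sumC {q : ℂ} (h0 : q ≠ 0) (h1 : ‖q‖ < 1) (n : ℕ) :
    HasSum (tC q n) (q ^ ((n : ℤ) ^ 2 - n) * ri q (2 * n)) := by
  cases n with
  | zero =>
    have : HasSum (tC q ((0 : ℕ) : ℤ)) (tC q ((0 : ℕ) : ℤ) 0) := by
      apply hasSum_single
      intro m hm
      unfold tC
      rw [Nat.cast_zero, vv_zero_off _ _ (by omega), vv_zero_off _ _ (by omega)]
      simp
    convert this using 1
    unfold tC
    rw [Nat.cast_zero, vv_zero_off q (3 * 0 + 2) (by omega)]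
    simp [vv, ri_zero]
  | succ n =>
    have hB := sumB_of_A h0 h1 n (by omega) (sumA h0 h1 n)
    have := stepBC h0 h1 (n + 1) _ hB
    push_cast
    refine hasSum_scale (one_sub_zpow_ne h1 (2 * ((n : ℤ) + 1)) (by omega)) ?_
    convert this using 1
    have r := ri_rec h1 (2 * ((n : ℤ) + 1))
    rw [show 2 * ((n : ℤ) + 1) - 1 = 2 * n + 1 by ring] at r
    rw [r, show ((n : ℤ) + 1) ^ 2 - (n + 1) = n ^ 2 + n by ring]
    ring

noncomputable def pj (q x y : ℂ) (N j : ℕ) : ℂ :=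
  qp q x j * qp q y j * qp q (q / (x * y)) (N - j) * (q / (x * y)) ^ j * ri q ((N : ℤ) - j)

lemma saal_poly (q x y u m R : ℂ) (hx : x ≠ 0) (hy : y ≠ 0) (hR : R ≠ 0) :
    (1 - u * m * q * R⁻¹) * (1 - u * m * q * R) * (1 - q / (x * y) * m)
      - (1 - q / x * (u * m)) * (1 - q / y * (u * m)) * (1 - m * q)
    = - m * (1 - x * u) * (1 - y * u) * (q / (x * y)) * (1 - m * q)
      + m * q * (1 - q / (x * y) * m) * (1 - u * R⁻¹) * (1 - u * R) := by
  field_simp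
  ring

lemma saal_tel {q x y : ℂ} (h0 : q ≠ 0) (h1 : ‖q‖ < 1) (hx : x ≠ 0) (hy : y ≠ 0) (r : ℤ)
    (N k : ℕ) (hk : k ≤ N + 1) :
    ∑ j ∈ Finset.range k, ((1 - q ^ ((N : ℤ) + 1 - r)) * (1 - q ^ ((N : ℤ) + 1 + r)) *
        (pj q x y (N + 1) j * vv q (j - r) (j + r))
      - (1 - q / x * q ^ N) * (1 - q / y * q ^ N) * (pj q x y N j * vv q (j - r) (j + r)))
    = - q ^ (N + 1 - k) * pj q x y (N + 1) k * vv q (k - r - 1) (k + r - 1) := by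
  induction k with
  | zero =>
    have : vv q (((0 : ℕ) : ℤ) - r - 1) (((0 : ℕ) : ℤ) + r - 1) = 0 := by
      by_contra hc
      have := vv_supp _ _ _ hc
      omega
    rw [this]; simp
  | succ k ih =>
    rw [Finset.sum_range_succ, ih (by omega)]
    obtain ⟨d, rfl⟩ : ∃ d, N = k + d := ⟨N - k, by omega⟩
    have e1 : k + d + 1 - (k + 1) = d := by omega
    have e2 : k + d + 1 - k = d + 1 := by omega
    have e3 : k + d - k = d := by omega
    have r1 : ri q d = (1 - q ^ d * q) * ri q (d + 1) := by
      have := ri_rec h1 ((d : ℤ) + 1)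
      rw [add_sub_cancel_right] at this
      rw [this, zpow_add₀ h0]; simp
    have r2 : vv q (k - r - 1) (k + r - 1)
        = (1 - q ^ k * (q ^ r)⁻¹) * (1 - q ^ k * q ^ r) * vv q (k - r) (k + r) := by
      unfold vv
      rw [ri_rec h1, ri_rec h1, zpow_add₀ h0, zpow_sub₀ h0, zpow_natCast]; ring
    have z1 : q ^ (((k + d : ℕ) : ℤ) + 1 - r) = q ^ k * q ^ d * q * (q ^ r)⁻¹ := by
      rw [zpow_sub₀ h0, zpow_add₀ h0, zpow_natCast, pow_add, zpow_one]; ring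
    have z2 : q ^ (((k + d : ℕ) : ℤ) + 1 + r) = q ^ k * q ^ d * q * q ^ r := by
      rw [zpow_add₀ h0, zpow_add₀ h0, zpow_natCast, pow_add, zpow_one]
    have v3 : vv q (((k + 1 : ℕ) : ℤ) - r - 1) (((k + 1 : ℕ) : ℤ) + r - 1)
        = vv q (k - r) (k + r) := by
      apply vvc <;> push_cast <;> ring
    have p1 : pj q x y (k + d + 1) k = qp q x k * qp q y k * (qp q (q / (x * y)) d *
        (1 - q / (x * y) * q ^ d)) * (q / (x * y)) ^ k * ri q (d + 1) := by
      unfold pj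
      rw [e2, qp_succ q (q / (x * y)),
        show ((k + d + 1 : ℕ) : ℤ) - (k : ℤ) = d + 1 by push_cast; ring]
    have p2 : pj q x y (k + d) k = qp q x k * qp q y k * qp q (q / (x * y)) d
        * (q / (x * y)) ^ k * ((1 - q ^ d * q) * ri q (d + 1)) := by
      unfold pj
      rw [e3, ← r1, show ((k + d : ℕ) : ℤ) - (k : ℤ) = d by push_cast; ring]
    have p3 : pj q x y (k + d + 1) (k + 1) = (qp q x k * (1 - x * q ^ k)) *
        (qp q y k * (1 - y * q ^ k)) * qp q (q / (x * y)) d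
        * (q / (x * y)) ^ (k + 1) * ((1 - q ^ d * q) * ri q (d + 1)) := by
      unfold pj
      rw [e1, ← r1, qp_succ q x, qp_succ q y,
        show ((k + d + 1 : ℕ) : ℤ) - ((k + 1 : ℕ) : ℤ) = d by push_cast; ring]
    rw [z1, z2, v3, p1, p2, p3, r2, e1, e2, pow_add q k d]
    have key := saal_poly q x y (q ^ k) (q ^ d) (q ^ r) hx hy (zpow_ne_zero _ h0)
    generalize q / (x * y) = Z at *
    linear_combination (qp q x k * qp q y k * qp q Z d * Z ^ k * ri q (d + 1) *
      vv q (k - r) (k + r)) * key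

noncomputable def ss (q x y : ℂ) (r : ℤ) (N : ℕ) : ℂ :=
  ∑ j ∈ Finset.range (N + 1), pj q x y N j * vv q (j - r) (j + r)

lemma saal_rec {q x y : ℂ} (h0 : q ≠ 0) (h1 : ‖q‖ < 1) (hx : x ≠ 0) (hy : y ≠ 0) (r : ℤ)
    (N : ℕ) : (1 - q ^ ((N : ℤ) + 1 - r)) * (1 - q ^ ((N : ℤ) + 1 + r)) * ss q x y r (N + 1)
      = (1 - q / x * q ^ N) * (1 - q / y * q ^ N) * ss q x y r N := by
  have := saal_tel h0 h1 hx hy r N (N + 1) le_rfl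
  rw [Finset.sum_sub_distrib, ← Finset.mul_sum, ← Finset.mul_sum] at this
  have v : vv q (((N + 1 : ℕ) : ℤ) - r - 1) (((N + 1 : ℕ) : ℤ) + r - 1)
      = (1 - q ^ ((N : ℤ) + 1 - r)) * (1 - q ^ ((N : ℤ) + 1 + r)) *
        vv q (((N + 1 : ℕ) : ℤ) - r) (((N + 1 : ℕ) : ℤ) + r) := by
    unfold vv
    rw [ri_rec h1, ri_rec h1]; push_cast; ring
  rw [v] at this
  unfold ss
  rw [Finset.sum_range_succ _ (N + 1)]
  simp only [Nat.sub_self, pow_zero] at this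
  linear_combination this

lemma saal {q x y : ℂ} (h0 : q ≠ 0) (h1 : ‖q‖ < 1) (hx : x ≠ 0) (hy : y ≠ 0) (r : ℕ) (G : ℂ)
    (hG : qp q (q / x) r * qp q (q / y) r * G = qp q x r * qp q y r * (q / (x * y)) ^ r)
    (N : ℕ) : ss q x y r N
      = qp q (q / x) N * qp q (q / y) N * G * vv q (N - r) (N + r) := by
  have hz : ∀ j : ℕ, j < r → vv q ((j : ℤ) - r) (j + r) = 0 := by
    intro j hj
    by_contra hc
    have := vv_supp _ _ _ hc
    omega
  rcases lt_or_ge N r with h | h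
  · rw [hz N h, mul_zero]
    apply Finset.sum_eq_zero
    intro j hj
    rw [Finset.mem_range] at hj
    rw [hz j (by omega), mul_zero]
  · induction N, h using Nat.le_induction with
    | base =>
      rw [ss, Finset.sum_range_succ, Finset.sum_eq_zero, zero_add, hG]
      · simp [pj, ri_zero, qp_zero]
      · intro j hj
        rw [hz j (Finset.mem_range.mp hj), mul_zero]
    | succ N hN ih =>
      have hrec := saal_rec h0 h1 hx hy r N
      have n1 : 1 - q ^ ((N : ℤ) + 1 - r) ≠ 0 := one_sub_zpow_ne h1 _ (by omega)
      have n2 : 1 - q ^ ((N : ℤ) + 1 + r) ≠ 0 := one_sub_zpow_ne h1 _ (by omega)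
      apply mul_left_cancel₀ (mul_ne_zero n1 n2)
      rw [hrec, ih, qp_succ, qp_succ]
      have v : vv q ((N : ℤ) - r) (N + r)
          = (1 - q ^ ((N : ℤ) + 1 - r)) * (1 - q ^ ((N : ℤ) + 1 + r)) *
          vv q (((N + 1 : ℕ) : ℤ) - r) (((N + 1 : ℕ) : ℤ) + r) := by
        have a1 := ri_rec h1 ((N : ℤ) + 1 - r)
        have a2 := ri_rec h1 ((N : ℤ) + 1 + r)
        rw [show (N : ℤ) + 1 - r - 1 = N - r by ring] at a1
        rw [show (N : ℤ) + 1 + r - 1 = N + r by ring] at a2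
        unfold vv
        rw [a1, a2]; push_cast; ring
      rw [v]; ring

lemma ss_neg (q x y : ℂ) (r : ℤ) (N : ℕ) : ss q x y (-r) N = ss q x y r N := by
  unfold ss
  apply Finset.sum_congr rfl
  intro j _
  rw [vvs q (show (j : ℤ) - -r = j + r by ring) (show (j : ℤ) + -r = j - r by ring)]

open Filter Topology in
lemma qp_tendsto {q : ℂ} (h1 : ‖q‖ < 1) (z : ℂ) :
    Tendsto (qp q z) atTop (𝓝 (qpInf q z)) := by
  have hs : Summable (fun i : ℕ => ‖-(z * q ^ i)‖) := by
    simp only [norm_neg, norm_mul, norm_pow]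
    exact (summable_geometric_of_lt_one (norm_nonneg q) h1).mul_left _
  have := (multipliable_one_add_of_summable hs).tendsto_prod_tprod_nat
  simp only [← sub_eq_add_neg] at this
  exact this

lemma qpInf_ne {q : ℂ} (h1 : ‖q‖ < 1) (z : ℂ) (hz : ∀ i : ℕ, 1 - z * q ^ i ≠ 0) :
    qpInf q z ≠ 0 := by
  have hs : Summable (fun i : ℕ => ‖-(z * q ^ i)‖) := by
    simp only [norm_neg, norm_mul, norm_pow]
    exact (summable_geometric_of_lt_one (norm_nonneg q) h1).mul_left _
  have := tprod_one_add_ne_zero_of_summable (f := fun i : ℕ => -(z * q ^ i))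
    (by simpa only [← sub_eq_add_neg] using hz) hs
  simp only [← sub_eq_add_neg] at this
  exact this

open Filter Topology in
lemma qpInf_step {q : ℂ} (h1 : ‖q‖ < 1) (z : ℂ) : qpInf q z = (1 - z) * qpInf q (z * q) := by
  have a := (qp_tendsto h1 z).comp (tendsto_add_atTop_nat 1)
  have b := (qp_tendsto h1 (z * q)).const_mul (1 - z)
  refine tendsto_nhds_unique a (b.congr fun n => ?_)
  exact (qp_succ' q z n).symm

open Filter Topology in
lemma bdd_of_tendsto {u : ℕ → ℂ} {l : ℂ} (h : Tendsto u atTop (𝓝 l)) :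
    ∃ C : ℝ, 0 ≤ C ∧ ∀ n, ‖u n‖ ≤ C := by
  obtain ⟨C, hC⟩ := h.norm.bddAbove_range
  have h' : ∀ n, ‖u n‖ ≤ C := fun n => hC ⟨n, rfl⟩
  exact ⟨C, (norm_nonneg _).trans (h' 0), h'⟩

lemma ri_bdd {q : ℂ} (h1 : ‖q‖ < 1) (hq : qpInf q q ≠ 0) :
    ∃ C : ℝ, 0 ≤ C ∧ ∀ k, ‖ri q k‖ ≤ C := by
  obtain ⟨C, hC0, hC⟩ := bdd_of_tendsto ((qp_tendsto h1 q).inv₀ hq)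
  refine ⟨C, hC0, fun k => ?_⟩
  unfold ri
  split_ifs
  · simpa using hC0
  · exact hC _

open Filter Topology in
lemma ri_tendsto {q : ℂ} (h1 : ‖q‖ < 1) (hq : qpInf q q ≠ 0) :
    Tendsto (ri q) atTop (𝓝 (qpInf q q)⁻¹) := by
  have ht : Tendsto Int.toNat atTop atTop :=
    tendsto_atTop_atTop.mpr fun b => ⟨b, fun a ha => by omega⟩
  refine (((qp_tendsto h1 q).inv₀ hq).comp ht).congr' ?_
  filter_upwards [eventually_ge_atTop 0] with k hk
  simp [ri, not_lt.mpr hk]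

open Filter Topology in
lemma vv_tendsto {q : ℂ} (h1 : ‖q‖ < 1) (hq : qpInf q q ≠ 0) (r : ℤ) :
    Tendsto (fun N : ℕ => vv q (N - r) (N + r)) atTop
      (𝓝 ((qpInf q q)⁻¹ * (qpInf q q)⁻¹)) := by
  have hc : Tendsto (fun N : ℕ => (N : ℤ)) atTop atTop := tendsto_natCast_atTop_atTop
  exact ((ri_tendsto h1 hq).comp (tendsto_atTop_add_const_right _ (-r) hc)).mul
    ((ri_tendsto h1 hq).comp (tendsto_atTop_add_const_right _ r hc))

noncomputable def gg (q x y : ℂ) (r : ℤ) : ℂ :=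
  (zqp q x r * zqp q y r / (zqp q (q / x) r * zqp q (q / y) r)) * (1 / (x * y)) ^ r * q ^ r

lemma zqp_succ {q : ℂ} (h0 : q ≠ 0) (h1 : ‖q‖ < 1) (z : ℂ) (r : ℤ) (h : 1 - z * q ^ r ≠ 0) :
    zqp q z (r + 1) = zqp q z r * (1 - z * q ^ r) := by
  unfold zqp
  have : qpInf q (z * q ^ r) = (1 - z * q ^ r) * qpInf q (z * q ^ (r + 1)) := by
    rw [qpInf_step h1, zpow_add_one₀ h0, mul_assoc]
  rw [this]
  field_simp

/-- Genericity. -/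
lemma gen1 {q x : ℂ} (h0 : q ≠ 0) (h1 : ‖q‖ < 1)
    (hdx : ∀ n : ℤ, zqp q (q / x) n ≠ 0) (n : ℤ) : 1 - q / x * q ^ n ≠ 0 := by
  intro h
  apply hdx n
  unfold zqp
  rw [qpInf_step h1 (q / x * q ^ n), h]
  simp

lemma gen2 {q x : ℂ} (h0 : q ≠ 0) (h1 : ‖q‖ < 1) (hx : x ≠ 0)
    (hdx : ∀ n : ℤ, zqp q (q / x) n ≠ 0) (n : ℤ) : 1 - x * q ^ n ≠ 0 := by
  intro h
  apply gen1 h0 h1 hdx (-n - 1)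
  have hn : q ^ n ≠ 0 := zpow_ne_zero _ h0
  rw [zpow_sub₀ h0, zpow_neg, zpow_one]
  field_simp
  linear_combination -h

lemma zqp_zero {q : ℂ} (z : ℂ) (h : qpInf q z ≠ 0) : zqp q z 0 = 1 := by
  simp [zqp, h]

lemma gg_succ {q x y : ℂ} (h0 : q ≠ 0) (h1 : ‖q‖ < 1) (hx : x ≠ 0) (hy : y ≠ 0)
    (hdx : ∀ n : ℤ, zqp q (q / x) n ≠ 0) (hdy : ∀ n : ℤ, zqp q (q / y) n ≠ 0) (r : ℤ) :
    gg q x y (r + 1) * ((1 - q / x * q ^ r) * (1 - q / y * q ^ r))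
      = gg q x y r * ((1 - x * q ^ r) * (1 - y * q ^ r) * (q / (x * y))) := by
  have a1 := gen1 h0 h1 hdx r
  have a2 := gen1 h0 h1 hdy r
  have a3 := gen2 h0 h1 hx hdx r
  have a4 := gen2 h0 h1 hy hdy r
  have hxy : 1 / (x * y) ≠ 0 := one_div_ne_zero (mul_ne_zero hx hy)
  unfold gg
  rw [zqp_succ h0 h1 _ r a1, zqp_succ h0 h1 _ r a2, zqp_succ h0 h1 _ r a3, zqp_succ h0 h1 _ r a4,
    zpow_add_one₀ h0, zpow_add_one₀ hxy]
  have b1 := hdx r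
  have b2 := hdy r
  generalize zqp q (q / x) r = A at *
  generalize zqp q (q / y) r = B at *
  generalize 1 - q / x * q ^ r = A' at *
  generalize 1 - q / y * q ^ r = B' at *
  field_simp

lemma gg_zero {q x y : ℂ} (h0 : q ≠ 0) (h1 : ‖q‖ < 1) (hx : x ≠ 0) (hy : y ≠ 0)
    (hdx : ∀ n : ℤ, zqp q (q / x) n ≠ 0) (hdy : ∀ n : ℤ, zqp q (q / y) n ≠ 0) :
    gg q x y 0 = 1 := by
  unfold gg
  rw [zqp_zero x (qpInf_ne h1 x fun i => by exact_mod_cast gen2 h0 h1 hx hdx i),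
    zqp_zero y (qpInf_ne h1 y fun i => by exact_mod_cast gen2 h0 h1 hy hdy i),
    zqp_zero (q / x) (qpInf_ne h1 _ fun i => by exact_mod_cast gen1 h0 h1 hdx i),
    zqp_zero (q / y) (qpInf_ne h1 _ fun i => by exact_mod_cast gen1 h0 h1 hdy i)]
  simp

lemma gg_nat {q x y : ℂ} (h0 : q ≠ 0) (h1 : ‖q‖ < 1) (hx : x ≠ 0) (hy : y ≠ 0)
    (hdx : ∀ n : ℤ, zqp q (q / x) n ≠ 0) (hdy : ∀ n : ℤ, zqp q (q / y) n ≠ 0) (r : ℕ) :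
    qp q (q / x) r * qp q (q / y) r * gg q x y r
      = qp q x r * qp q y r * (q / (x * y)) ^ r := by
  induction r with
  | zero => simp [qp_zero, gg_zero h0 h1 hx hy hdx hdy]
  | succ r ih =>
    have := gg_succ h0 h1 hx hy hdx hdy r
    rw [zpow_natCast] at this
    simp only [qp_succ, pow_succ]
    push_cast
    linear_combination (qp q (q / x) r * qp q (q / y) r) * this
      + ((1 - x * q ^ r) * (1 - y * q ^ r) * (q / (x * y))) * ih

lemma gg_neg {q x y : ℂ} (h0 : q ≠ 0) (h1 : ‖q‖ < 1) (hx : x ≠ 0) (hy : y ≠ 0)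
    (hdx : ∀ n : ℤ, zqp q (q / x) n ≠ 0) (hdy : ∀ n : ℤ, zqp q (q / y) n ≠ 0) (r : ℕ) :
    gg q x y (-r) = gg q x y r := by
  induction r with
  | zero => simp
  | succ r ih =>
    have e1 := gg_succ h0 h1 hx hy hdx hdy r
    have e2 := gg_succ h0 h1 hx hy hdx hdy (-r - 1)
    rw [sub_add_cancel, ih] at e2
    push_cast
    rw [neg_add, ← sub_eq_add_neg]
    have a1 := gen1 h0 h1 hdx r
    have a2 := gen1 h0 h1 hdy r
    have a3 := gen2 h0 h1 hx hdx r
    have a4 := gen2 h0 h1 hy hdy r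
    have hn : q ^ (r : ℤ) ≠ 0 := zpow_ne_zero _ h0
    rw [zpow_sub₀ h0, zpow_neg, zpow_one] at e2
    generalize q ^ (r : ℤ) = u at *
    have f1 : 1 - q / x * (u⁻¹ / q) = - (1 - x * u) / (x * u) := by field_simp; ring
    have f2 : 1 - q / y * (u⁻¹ / q) = - (1 - y * u) / (y * u) := by field_simp; ring
    have f3 : 1 - x * (u⁻¹ / q) = - (1 - q / x * u) * x / (q * u) := by field_simp; ring
    have f4 : 1 - y * (u⁻¹ / q) = - (1 - q / y * u) * y / (q * u) := by field_simp; ring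
    rw [f1, f2, f3, f4] at e2
    apply mul_right_cancel₀ (mul_ne_zero a1 a2)
    rw [e1]
    generalize 1 - q / x * u = A at *
    generalize 1 - q / y * u = B at *
    generalize 1 - x * u = C at *
    generalize 1 - y * u = D at *
    field_simp at e2 ⊢
    linear_combination -e2

lemma gg_bdd {q x y : ℂ} (h0 : q ≠ 0) (h1 : ‖q‖ < 1) (hx : x ≠ 0) (hy : y ≠ 0)
    (hdx : ∀ n : ℤ, zqp q (q / x) n ≠ 0) (hdy : ∀ n : ℤ, zqp q (q / y) n ≠ 0) :
    ∃ C : ℝ, 0 ≤ C ∧ ∀ r : ℤ, ‖gg q x y r‖ ≤ C * ‖q / (x * y)‖ ^ r.natAbs := by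
  have g1 : ∀ i : ℕ, 1 - q / x * q ^ i ≠ 0 := fun i => by exact_mod_cast gen1 h0 h1 hdx i
  have g2 : ∀ i : ℕ, 1 - q / y * q ^ i ≠ 0 := fun i => by exact_mod_cast gen1 h0 h1 hdy i
  have t := (((qp_tendsto h1 x).mul (qp_tendsto h1 y)).mul
    ((qp_tendsto h1 (q / x)).inv₀ (qpInf_ne h1 _ g1))).mul
    ((qp_tendsto h1 (q / y)).inv₀ (qpInf_ne h1 _ g2))
  obtain ⟨C, hC0, hC⟩ := bdd_of_tendsto t
  have hnat : ∀ r : ℕ, ‖gg q x y r‖ ≤ C * ‖q / (x * y)‖ ^ r := by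
    intro r
    have e := gg_nat h0 h1 hx hy hdx hdy r
    have n1 : qp q (q / x) r ≠ 0 := by
      rw [qp, Finset.prod_ne_zero_iff]; exact fun i _ => g1 i
    have n2 : qp q (q / y) r ≠ 0 := by
      rw [qp, Finset.prod_ne_zero_iff]; exact fun i _ => g2 i
    have : gg q x y r = qp q x r * qp q y r * (qp q (q / x) r)⁻¹ * (qp q (q / y) r)⁻¹
        * (q / (x * y)) ^ r := by
      generalize q / (x * y) = Z at *
      generalize qp q (q / x) r = A at *
      generalize qp q (q / y) r = B at *
      field_simp
      linear_combination e
    rw [this, norm_mul, norm_pow]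
    exact mul_le_mul_of_nonneg_right (hC r) (by positivity)
  refine ⟨C, hC0, fun r => ?_⟩
  obtain ⟨n, rfl | rfl⟩ := r.eq_nat_or_neg
  · simpa using hnat n
  · rw [gg_neg h0 h1 hx hy hdx hdy]; simpa using hnat n

lemma summ_gauss {t D : ℝ} (ht : 0 ≤ t) (h1 : t < 1) (hD : 0 ≤ D) :
    Summable (fun n : ℕ => t ^ (n ^ 2) * D ^ n) := by
  have hz : Filter.Tendsto (fun n : ℕ => t ^ n * D) Filter.atTop (nhds 0) := by
    simpa using (tendsto_pow_atTop_nhds_zero_of_lt_one ht h1).mul_const D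
  have hev : ∀ᶠ n : ℕ in Filter.atTop, t ^ n * D ≤ 1 / 2 :=
    (hz.eventually (gt_mem_nhds (by norm_num : (0 : ℝ) < 1 / 2))).mono fun n h => h.le
  refine summable_of_isBigO_nat (g := fun n : ℕ => (1 / 2 : ℝ) ^ n)
    (summable_geometric_of_lt_one (by norm_num) (by norm_num)) ?_
  refine Asymptotics.IsBigO.of_bound 1 ?_
  filter_upwards [hev] with n hn
  rw [show t ^ (n ^ 2) * D ^ n = (t ^ n * D) ^ n by rw [mul_pow, ← pow_mul, sq]]
  have : 0 ≤ t ^ n * D := by positivity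
  rw [Real.norm_of_nonneg (by positivity), Real.norm_of_nonneg (by positivity), one_mul]
  exact pow_le_pow_left₀ this hn n

lemma fam_summ {q x y : ℂ} (h0 : q ≠ 0) (h1 : ‖q‖ < 1) (hx : x ≠ 0) (hy : y ≠ 0)
    (hdx : ∀ n : ℤ, zqp q (q / x) n ≠ 0) (hdy : ∀ n : ℤ, zqp q (q / y) n ≠ 0)
    (e r : ℤ → ℤ) (he : ∀ m, m ^ 2 ≤ e m) (hr : ∀ m, (r m).natAbs ≤ 3 * m.natAbs + 2) :
    Summable (fun m => ‖q ^ (e m) * gg q x y (r m)‖) := by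
  obtain ⟨C, hC0, hC⟩ := gg_bdd h0 h1 hx hy hdx hdy
  set T : ℝ := ‖q / (x * y)‖ + 1 with hT
  have hT0 : 0 ≤ ‖q / (x * y)‖ := norm_nonneg _
  have hb : Summable (fun m : ℤ => C * T ^ 2 * (‖q‖ ^ (m.natAbs ^ 2) * (T ^ 3) ^ m.natAbs)) := by
    apply Summable.mul_left
    have := summ_gauss (norm_nonneg q) h1 (D := T ^ 3) (by positivity)
    apply Summable.of_nat_of_neg <;> simpa using this
  refine Summable.of_nonneg_of_le (fun _ => norm_nonneg _) (fun m => ?_) hb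
  rw [norm_mul]
  have b1 : ‖q ^ (e m)‖ ≤ ‖q‖ ^ (m.natAbs ^ 2) := by
    have hle := he m
    have h2 : 0 ≤ m ^ 2 := sq_nonneg m
    obtain ⟨k, hk⟩ : ∃ k : ℕ, e m = k := ⟨(e m).toNat, by omega⟩
    rw [hk, zpow_natCast, norm_pow]
    apply pow_le_pow_of_le_one (norm_nonneg q) h1.le
    zify
    rw [sq_abs]; omega
  have b2 : ‖gg q x y (r m)‖ ≤ C * (T ^ 2 * (T ^ 3) ^ m.natAbs) := by
    refine (hC _).trans (mul_le_mul_of_nonneg_left ?_ hC0)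
    calc ‖q / (x * y)‖ ^ (r m).natAbs ≤ T ^ (r m).natAbs :=
          pow_le_pow_left₀ hT0 (by linarith) _
      _ ≤ T ^ (3 * m.natAbs + 2) := pow_le_pow_right₀ (by linarith) (hr m)
      _ = _ := by rw [pow_add, pow_mul, mul_comm]
  calc _ ≤ ‖q‖ ^ (m.natAbs ^ 2) * (C * (T ^ 2 * (T ^ 3) ^ m.natAbs)) :=
        mul_le_mul b1 b2 (norm_nonneg _) (by positivity)
    _ = _ := by ring

noncomputable def fam (q x y : ℂ) (e r : ℤ → ℤ) (N : ℕ) (m : ℤ) : ℂ :=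
  q ^ (e m) * gg q x y (r m) * vv q (N - r m) (N + r m)

lemma ss_eq {q x y : ℂ} (h0 : q ≠ 0) (h1 : ‖q‖ < 1) (hx : x ≠ 0) (hy : y ≠ 0)
    (hdx : ∀ n : ℤ, zqp q (q / x) n ≠ 0) (hdy : ∀ n : ℤ, zqp q (q / y) n ≠ 0) (r : ℤ) (N : ℕ) :
    ss q x y r N = qp q (q / x) N * qp q (q / y) N * gg q x y r * vv q (N - r) (N + r) := by
  obtain ⟨n, rfl | rfl⟩ := r.eq_nat_or_neg
  · exact saal h0 h1 hx hy n _ (gg_nat h0 h1 hx hy hdx hdy n) N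
  · rw [ss_neg, gg_neg h0 h1 hx hy hdx hdy,
      saal h0 h1 hx hy n _ (gg_nat h0 h1 hx hy hdx hdy n) N,
      vvs q (show (N : ℤ) - n = N + -n by ring) (show (N : ℤ) + n = N - -n by ring)]

lemma fam_bound {q x y : ℂ} (e r : ℤ → ℤ) {C : ℝ} (hC0 : 0 ≤ C) (hC : ∀ k, ‖ri q k‖ ≤ C)
    (N : ℕ) (m : ℤ) :
    ‖fam q x y e r N m‖ ≤ ‖q ^ (e m) * gg q x y (r m)‖ * (C * C) := by
  unfold fam vv
  rw [norm_mul _ (_ * _), norm_mul (ri q _)]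
  exact mul_le_mul_of_nonneg_left (mul_le_mul (hC _) (hC _) (norm_nonneg _) hC0) (norm_nonneg _)

open Filter Topology in
lemma fam_main {q x y : ℂ} (h0 : q ≠ 0) (h1 : ‖q‖ < 1) (hx : x ≠ 0) (hy : y ≠ 0)
    (hdx : ∀ n : ℤ, zqp q (q / x) n ≠ 0) (hdy : ∀ n : ℤ, zqp q (q / y) n ≠ 0)
    (hq : qpInf q q ≠ 0)
    (e r : ℤ → ℤ) (he : ∀ m, m ^ 2 ≤ e m) (hr : ∀ m, (r m).natAbs ≤ 3 * m.natAbs + 2) :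
    (∀ N, Summable (fam q x y e r N)) ∧
    Tendsto (fun N => ∑' m, fam q x y e r N m) atTop
      (𝓝 ((∑' m, q ^ (e m) * gg q x y (r m)) * ((qpInf q q)⁻¹ * (qpInf q q)⁻¹))) := by
  obtain ⟨C, hC0, hC⟩ := ri_bdd h1 hq
  have hs := (fam_summ h0 h1 hx hy hdx hdy e r he hr).mul_right (C * C)
  constructor
  · intro N
    exact Summable.of_norm_bounded hs (fam_bound e r hC0 hC N)
  · rw [← tsum_mul_right]
    refine tendsto_tsum_of_dominated_convergence hs (fun m => ?_)
      (Eventually.of_forall fun N m => fam_bound e r hC0 hC N m)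
    exact (vv_tendsto h1 hq (r m)).const_mul _

noncomputable def cc (q : ℂ) (j : ℕ) : ℂ :=
  q ^ ((j : ℤ) ^ 2) * ri q (2 * j) - q ^ ((j : ℤ) ^ 2 - j) * ri q (2 * j)

open Filter Topology in
lemma lhs_main {q : ℂ} (x y : ℂ) (h0 : q ≠ 0) (h1 : ‖q‖ < 1) (hq : qpInf q q ≠ 0) :
    Tendsto (fun N => ∑' j, pj q x y N j * cc q j) atTop
      (𝓝 ((∑' j : ℕ, qp q x j * qp q y j * (q / (x * y)) ^ j * cc q j)
        * (qpInf q (q / (x * y)) * (qpInf q q)⁻¹))) := by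
  obtain ⟨C, hC0, hC⟩ := ri_bdd h1 hq
  obtain ⟨X, hX0, hX⟩ := bdd_of_tendsto (qp_tendsto h1 x)
  obtain ⟨Y, hY0, hY⟩ := bdd_of_tendsto (qp_tendsto h1 y)
  set Z := q / (x * y) with hZ
  obtain ⟨W, hW0, hW⟩ := bdd_of_tendsto (qp_tendsto h1 Z)
  have s1 := summ_gauss (norm_nonneg q) h1 (norm_nonneg Z)
  have s2 := summ_gauss (norm_nonneg q) h1 (D := ‖Z‖ / ‖q‖) (by positivity)
  have hs := (s1.add s2).mul_left (X * Y * W * C * C)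
  have hq0 : ‖q‖ ≠ 0 := norm_ne_zero_iff.mpr h0
  rw [← tsum_mul_right]
  refine tendsto_tsum_of_dominated_convergence hs (fun j => ?_)
      (Eventually.of_forall fun N j => ?_)
  · have hc : Tendsto (fun N : ℕ => (N : ℤ)) atTop atTop := tendsto_natCast_atTop_atTop
    have t1 := (ri_tendsto h1 hq).comp (tendsto_atTop_add_const_right _ (-(j : ℤ)) hc)
    have t2 := (qp_tendsto h1 Z).comp (tendsto_sub_atTop_nat j)
    have := (t2.mul t1).const_mul (qp q x j * qp q y j * Z ^ j * cc q j)
    refine this.congr fun N => ?_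
    simp only [Function.comp, pj, ← sub_eq_add_neg]
    rw [← hZ]
    ring
  · have hcc : ‖cc q j‖ ≤ (‖q‖ ^ (j ^ 2) + ‖q‖ ^ (j ^ 2) / ‖q‖ ^ j) * C := by
      unfold cc
      rw [← sub_mul, norm_mul]
      refine mul_le_mul ?_ (hC _) (norm_nonneg _) (by positivity)
      refine (norm_sub_le _ _).trans (le_of_eq ?_)
      rw [zpow_sub₀ h0]
      have : q ^ ((j : ℤ) ^ 2) = q ^ (j ^ 2) := by exact_mod_cast zpow_natCast q (j ^ 2)
      rw [this, zpow_natCast, norm_div, norm_pow, norm_pow]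
    have hp : ‖pj q x y N j‖ ≤ X * Y * W * ‖Z‖ ^ j * C := by
      unfold pj
      rw [← hZ]
      simp only [norm_mul, norm_pow]
      gcongr
      · exact hX j
      · exact hY j
      · exact hW _
      · exact hC _
    rw [norm_mul]
    refine (mul_le_mul hp hcc (norm_nonneg _) (by positivity)).trans (le_of_eq ?_)
    rw [div_pow]
    field_simp

lemma fin_id {q x y : ℂ} (h0 : q ≠ 0) (h1 : ‖q‖ < 1) (hx : x ≠ 0) (hy : y ≠ 0)
    (hdx : ∀ n : ℤ, zqp q (q / x) n ≠ 0) (hdy : ∀ n : ℤ, zqp q (q / y) n ≠ 0) (N : ℕ) :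
    HasSum (fun m => qp q (q / x) N * qp q (q / y) N *
      (fam q x y (fun m => 3 * m ^ 2 - m) (fun m => 3 * m) N m
        - fam q x y (fun m => 3 * m ^ 2 - 2 * m) (fun m => 3 * m) N m
        - fam q x y (fun m => 3 * m ^ 2 + m) (fun m => 3 * m + 1) N m
        + fam q x y (fun m => 3 * m ^ 2 + 2 * m) (fun m => 3 * m + 2) N m))
      (∑' j, pj q x y N j * cc q j) := by
  rw [tsum_eq_sum (s := Finset.range (N + 1))]
  · have := hasSum_sum (s := Finset.range (N + 1)) (fun (j : ℕ) _ =>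
      ((sumA h0 h1 j).sub (sumC h0 h1 j)).mul_left (pj q x y N j))
    refine hs_congr (fun m => ?_) this
    have i0 := ss_eq h0 h1 hx hy hdx hdy (3 * m) N
    have i1 := ss_eq h0 h1 hx hy hdx hdy (3 * m + 1) N
    have i2 := ss_eq h0 h1 hx hy hdx hdy (3 * m + 2) N
    have : ∑ j ∈ Finset.range (N + 1), pj q x y N j * (tA q j m - tC q j m)
        = q ^ (3 * m ^ 2 - m) * ss q x y (3 * m) N - q ^ (3 * m ^ 2 - 2 * m) * ss q x y (3 * m) N
          - q ^ (3 * m ^ 2 + m) * ss q x y (3 * m + 1) N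
          + q ^ (3 * m ^ 2 + 2 * m) * ss q x y (3 * m + 2) N := by
      unfold ss tA tC
      simp only [Finset.mul_sum, ← Finset.sum_sub_distrib, ← Finset.sum_add_distrib]
      apply Finset.sum_congr rfl
      intro j _
      ring
    rw [this, i0, i1, i2]
    unfold fam
    ring
  · intro j hj
    rw [Finset.mem_range, not_lt] at hj
    rw [pj, ri_neg q (by omega)]
    simp

theorem stmt12 (q x y : ℂ) (h0 : 0 < ‖q‖) (h1 : ‖q‖ < 1) (hx : x ≠ 0) (hy : y ≠ 0)
    (hdx : ∀ n : ℤ, zqp q (q / x) n ≠ 0) (hdy : ∀ n : ℤ, zqp q (q / y) n ≠ 0)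
    (hq : qpInf q q ≠ 0) (hxy : qpInf q (q / (x * y)) ≠ 0) :
    ∑' n : ℕ, (qp q x n * qp q y n / qp q q (2 * n)) * (1 / (x * y)) ^ n * (q ^ n - 1) * q ^ n ^ 2
      = ((∑' n : ℤ, (zqp q x (3 * n) * zqp q y (3 * n) /
              (zqp q (q / x) (3 * n) * zqp q (q / y) (3 * n))) *
              (1 / (x * y)) ^ (3 * n) * q ^ (3 * n ^ 2 + 2 * n))
          - (∑' n : ℤ, (zqp q x (3 * n) * zqp q y (3 * n) /
              (zqp q (q / x) (3 * n) * zqp q (q / y) (3 * n))) *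
              (1 / (x * y)) ^ (3 * n) * q ^ (3 * n ^ 2 + n))
          - (∑' n : ℤ, (zqp q x (3 * n + 1) * zqp q y (3 * n + 1) /
              (zqp q (q / x) (3 * n + 1) * zqp q (q / y) (3 * n + 1))) *
              (1 / (x * y)) ^ (3 * n + 1) * q ^ (3 * n ^ 2 + 4 * n + 1))
          + (∑' n : ℤ, (zqp q x (3 * n + 2) * zqp q y (3 * n + 2) /
              (zqp q (q / x) (3 * n + 2) * zqp q (q / y) (3 * n + 2))) *
              (1 / (x * y)) ^ (3 * n + 2) * q ^ (3 * n ^ 2 + 5 * n + 2))) *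
        (qpInf q (q / x) * qpInf q (q / y)) / (qpInf q q * qpInf q (q / (x * y))) := by
  have hq0 : q ≠ 0 := norm_pos_iff.mp h0
  have hxy0 : 1 / (x * y) ≠ 0 := one_div_ne_zero (mul_ne_zero hx hy)
  obtain ⟨s1, l1⟩ := fam_main hq0 h1 hx hy hdx hdy hq
    (fun m => 3 * m ^ 2 - m) (fun m => 3 * m) (fun m => by nlinarith [Int.le_self_sq m])
    (fun m => by omega)
  obtain ⟨s2, l2⟩ := fam_main hq0 h1 hx hy hdx hdy hq
    (fun m => 3 * m ^ 2 - 2 * m) (fun m => 3 * m) (fun m => by nlinarith [Int.le_self_sq m])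
    (fun m => by omega)
  obtain ⟨s3, l3⟩ := fam_main hq0 h1 hx hy hdx hdy hq
    (fun m => 3 * m ^ 2 + m) (fun m => 3 * m + 1) (fun m => by nlinarith [Int.le_self_sq (-m)])
    (fun m => by omega)
  obtain ⟨s4, l4⟩ := fam_main hq0 h1 hx hy hdx hdy hq
    (fun m => 3 * m ^ 2 + 2 * m) (fun m => 3 * m + 2)
    (fun m => by nlinarith [Int.le_self_sq (-m)])
    (fun m => by omega)
  have lL := lhs_main x y hq0 h1 hq
  have lR := ((qp_tendsto h1 (q / x)).mul (qp_tendsto h1 (q / y))).mul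
    (((l1.sub l2).sub l3).add l4)
  have key := tendsto_nhds_unique lL (lR.congr fun N => by
    rw [← (fin_id hq0 h1 hx hy hdx hdy N).tsum_eq, tsum_mul_left,
      ((((s1 N).sub (s2 N)).sub (s3 N)).tsum_add (s4 N)),
      (((s1 N).sub (s2 N)).tsum_sub (s3 N)), (s1 N).tsum_sub (s2 N)])
  clear lR lL l1 l2 l3 l4 s1 s2 s3 s4
  have conv : ∀ (e r e' : ℤ), e' = e + r →
      (zqp q x r * zqp q y r / (zqp q (q / x) r * zqp q (q / y) r)) * (1 / (x * y)) ^ r * q ^ e'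
        = q ^ e * gg q x y r := by
    intro e r e' h
    rw [h, zpow_add₀ hq0, gg]
    ring
  have c1 := fun n : ℤ => conv (3 * n ^ 2 - n) (3 * n) (3 * n ^ 2 + 2 * n) (by ring)
  have c2 := fun n : ℤ => conv (3 * n ^ 2 - 2 * n) (3 * n) (3 * n ^ 2 + n) (by ring)
  have c3 := fun n : ℤ => conv (3 * n ^ 2 + n) (3 * n + 1) (3 * n ^ 2 + 4 * n + 1) (by ring)
  have c4 := fun n : ℤ => conv (3 * n ^ 2 + 2 * n) (3 * n + 2) (3 * n ^ 2 + 5 * n + 2) (by ring)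
  have cL : ∀ n : ℕ, (qp q x n * qp q y n / qp q q (2 * n)) * (1 / (x * y)) ^ n * (q ^ n - 1)
      * q ^ n ^ 2 = qp q x n * qp q y n * (q / (x * y)) ^ n * cc q n := by
    intro n
    have e1 : q ^ ((n : ℤ) ^ 2) = q ^ (n ^ 2) := by exact_mod_cast zpow_natCast q (n ^ 2)
    have e2 : ri q (2 * (n : ℤ)) = (qp q q (2 * n))⁻¹ := by exact_mod_cast ri_nat q (2 * n)
    have hn : q ^ n ≠ 0 := pow_ne_zero _ hq0
    have e3 : (q / (x * y)) ^ n = (1 / (x * y)) ^ n * q ^ n := by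
      rw [← mul_pow]; congr 1; ring
    unfold cc
    rw [zpow_sub₀ hq0, e1, e2, zpow_natCast, e3]
    generalize (1 / (x * y)) ^ n = V
    have := qpq_ne h1 (2 * n)
    field_simp
  simp only [c1, c2, c3, c4, cL]
  generalize (∑' n : ℕ, qp q x n * qp q y n * (q / (x * y)) ^ n * cc q n) = L at *
  simp only [← sub_mul, ← add_mul] at key
  generalize (∑' m : ℤ, q ^ (3 * m ^ 2 - m) * gg q x y (3 * m)) = S1 at *
  generalize (∑' m : ℤ, q ^ (3 * m ^ 2 - 2 * m) * gg q x y (3 * m)) = S2 at *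
  generalize (∑' m : ℤ, q ^ (3 * m ^ 2 + m) * gg q x y (3 * m + 1)) = S3 at *
  generalize (∑' m : ℤ, q ^ (3 * m ^ 2 + 2 * m) * gg q x y (3 * m + 2)) = S4 at *
  generalize qpInf q (q / (x * y)) = A at *
  generalize qpInf q q = B at *
  field_simp at key ⊢
  linear_combination key
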